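/- Let V be a finite-dimensional E-vector space and b a nondegenerate sesquilinear form on V with asymmetry x. Then x is an isometry of b, i.e. b(xv, xw) = b(v,w) for all v,w ∈ V. If moreover x is semisimple, then V = ker(x−1) ⊕ im(x−1), this decomposition is orthogonal with respect to b (b(v',v'') = b(v'',v') = 0 for v' ∈ im(x−1), v'' ∈ ker(x−1)), the restriction of b to ker(x−1) is a nondegenerate hermitian form, and the restriction of b to im(x−1) is a nondegenerate sesquilinear form. (The structural facts asserted in section 2.1 of the paper: for a semisimple element x̃ of the twisted group, the restriction of x̃ to V''_{x̃} defines a hermitian form and V = V'_{x̃} ⊕ V''_{x̃} is the associated orthogonal decomposition.) -/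

import Mathlib

/-- An automorphism of a quadratic extension is an involution. -/
theorem AlgEquiv.apply_apply_of_finrank_eq_two {F E : Type*} [Field F] [Field E] [Algebra F E]
    [FiniteDimensional F E] (hE : Module.finrank F E = 2) (c : E ≃ₐ[F] E) (a : E) :
    c (c a) = a := by
  have hcard : Nat.card (E ≃ₐ[F] E) ≤ 2 := by
    rw [Nat.card_eq_fintype_card, ← hE]
    exact AlgEquiv.card_le
  have hpos : 0 < Nat.card (E ≃ₐ[F] E) := Nat.card_pos
  have hdvd : Nat.card (E ≃ₐ[F] E) ∣ 2 := by
    interval_cases Nat.card (E ≃ₐ[F] E) <;> norm_num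
  have hc : c ^ 2 = 1 := orderOf_dvd_iff_pow_eq_one.mp ((orderOf_dvd_natCard c).trans hdvd)
  simpa [pow_two] using DFunLike.congr_fun hc a

/-- For a semisimple endomorphism `x` of a finite-dimensional space, the kernel and the range of
`x - 1` are complementary. -/
theorem Module.End.IsSemisimple.isCompl_ker_range_sub_one {E V : Type*} [Field E]
    [AddCommGroup V] [Module E V] [FiniteDimensional E V] {x : Module.End E V}
    (hx : x.IsSemisimple) : IsCompl (LinearMap.ker (x - 1)) (LinearMap.range (x - 1)) := by
  have hker : LinearMap.ker (x - 1) ∈ x.invtSubmodule := by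
    intro v hv
    have hv' : x v = v := by simpa [sub_eq_zero] using hv
    simp [hv']
  obtain ⟨W, hW, hcompl⟩ := Module.End.isSemisimple_iff.mp hx _ hker
  have hle : LinearMap.range (x - 1) ≤ W := by
    rintro _ ⟨v, rfl⟩
    obtain ⟨k, hk, w, hw, rfl⟩ := Submodule.mem_sup.mp
      (hcompl.sup_eq_top ▸ Submodule.mem_top : v ∈ LinearMap.ker (x - 1) ⊔ W)
    rw [map_add, LinearMap.mem_ker.mp hk, zero_add]
    exact W.sub_mem (hW hw) hw
  have hdisj := hcompl.disjoint.mono_right hle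
  refine ⟨hdisj, codisjoint_iff.mpr (Submodule.eq_top_of_disjoint _ _ ?_ hdisj)⟩
  rw [add_comm, LinearMap.finrank_range_add_finrank_ker]


/-- The asymmetry `x` of a nondegenerate sesquilinear form `b` is an isometry of `b`; if
moreover `x` is semisimple then `V = ker(x-1) ⊕ im(x-1)`, this decomposition is orthogonal
for `b`, the restriction of `b` to `ker(x-1)` is a nondegenerate hermitian form, and the
restriction of `b` to `im(x-1)` is a nondegenerate sesquilinear form. -/
theorem statement1
    (p : ℕ) [Fact p.Prime]
    (F : Type*) [Field F] [Algebra ℚ_[p] F] [FiniteDimensional ℚ_[p] F]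
    (absF : AbsoluteValue F ℝ)
    (habs : ∀ a b : F, absF (a + b) ≤ max (absF a) (absF b))
    (E : Type*) [Field E] [Algebra F E] [FiniteDimensional F E]
    (hE : Module.finrank F E = 2)
    (c : E ≃ₐ[F] E) (hc : ∃ a : E, c a ≠ a)
    (V : Type*) [AddCommGroup V] [Module E V] [Module F V] [IsScalarTower F E V]
    [FiniteDimensional E V]
    -- `b` is a nondegenerate sesquilinear form on `V`
    (b : V → V → E)
    (hb_addl : ∀ v v' w : V, b (v + v') w = b v w + b v' w)
    (hb_addr : ∀ v w w' : V, b v (w + w') = b v w + b v w')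
    (hb_sl : ∀ (a : E) (v w : V), b (a • v) w = c a * b v w)
    (hb_r : ∀ (a : E) (v w : V), b v (a • w) = a * b v w)
    (hb_ndl : ∀ v : V, (∀ w : V, b v w = 0) → v = 0)
    (hb_ndr : ∀ w : V, (∀ v : V, b v w = 0) → w = 0)
    -- `x` is the asymmetry of `b`
    (x : V →ₗ[E] V) (hx : ∀ v w : V, b v w = c (b w (x v))) :
    -- `x` is an isometry of `b`
    (∀ v w : V, b (x v) (x w) = b v w) ∧
    -- if moreover `x` is semisimple:
    (Module.End.IsSemisimple x →
      -- `V = ker(x-1) ⊕ im(x-1)`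
      (IsCompl (LinearMap.ker (x - 1)) (LinearMap.range (x - 1)) ∧
      -- the decomposition is `b`-orthogonal
      (∀ v' ∈ LinearMap.range (x - 1), ∀ v'' ∈ LinearMap.ker (x - 1),
          b v' v'' = 0 ∧ b v'' v' = 0) ∧
      -- the restriction of `b` to `ker(x-1)` is hermitian
      (∀ v'' ∈ LinearMap.ker (x - 1), ∀ w'' ∈ LinearMap.ker (x - 1),
          b v'' w'' = c (b w'' v'')) ∧
      -- ... and nondegenerate
      (∀ v'' ∈ LinearMap.ker (x - 1),
          (∀ w'' ∈ LinearMap.ker (x - 1), b v'' w'' = 0) → v'' = 0) ∧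
      (∀ w'' ∈ LinearMap.ker (x - 1),
          (∀ v'' ∈ LinearMap.ker (x - 1), b v'' w'' = 0) → w'' = 0) ∧
      -- the restriction of `b` to `im(x-1)` is nondegenerate (and sesquilinear)
      (∀ v' ∈ LinearMap.range (x - 1),
          (∀ w' ∈ LinearMap.range (x - 1), b v' w' = 0) → v' = 0) ∧
      (∀ w' ∈ LinearMap.range (x - 1),
          (∀ v' ∈ LinearMap.range (x - 1), b v' w' = 0) → w' = 0))) := by
  have hiso : ∀ v w : V, b (x v) (x w) = b v w := fun v w => by
    rw [hx v w, hx w (x v), AlgEquiv.apply_apply_of_finrank_eq_two hE]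
  refine ⟨hiso, fun hss => ?_⟩
  have hcompl := hss.isCompl_ker_range_sub_one
  have hfix : ∀ v ∈ LinearMap.ker (x - 1), x v = v := fun v hv => by
    simpa [sub_eq_zero] using hv
  have horth : ∀ v' ∈ LinearMap.range (x - 1), ∀ v'' ∈ LinearMap.ker (x - 1),
      b v' v'' = 0 ∧ b v'' v' = 0 := by
    rintro _ ⟨u, rfl⟩ k hk
    have hxu : (x - 1) u + u = x u := by simp
    have hl := hiso u k
    have hr := hiso k u
    rw [hfix k hk, ← hxu] at hl hr
    rw [hb_addl] at hl
    rw [hb_addr] at hr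
    exact ⟨by simpa using hl, by simpa using hr⟩
  have hdec : ∀ v : V, ∃ k ∈ LinearMap.ker (x - 1), ∃ r ∈ LinearMap.range (x - 1), k + r = v :=
    fun v => Submodule.mem_sup.mp (hcompl.sup_eq_top ▸ Submodule.mem_top)
  refine ⟨hcompl, horth, fun v hv w _ => ?_, fun v hv h => hb_ndl v fun u => ?_,
    fun w hw h => hb_ndr w fun u => ?_, fun v hv h => hb_ndl v fun u => ?_,
    fun w hw h => hb_ndr w fun u => ?_⟩
  · rw [hx v w, hfix v hv]
  all_goals obtain ⟨k, hk, r, hr, rfl⟩ := hdec u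
  · rw [hb_addr, h k hk, (horth r hr v hv).2, add_zero]
  · rw [hb_addl, h k hk, (horth r hr w hw).1, add_zero]
  · rw [hb_addr, h r hr, (horth v hv k hk).1, add_zero]
  · rw [hb_addl, h r hr, (horth w hw k hk).2, add_zero]
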